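/- Standardization theorem: for φ-terms t, s, if t ⇝* s then there exists a φ-term r such that t →h* r and r →ᵢ* s, where →h* and →ᵢ* are the reflexive-transitive closures of head reduction and internal reduction respectively. -/

import Mathlib

namespace PhiCalc

/-- φ-terms over a set of attribute labels `L`. An object term carries a finite
list of attributes: `(a, none)` is a void attribute, `(b, some t)` is an
attached attribute. -/
inductive Tm (L : Type) : Type where
  | loc : Nat → Tm L
  | dot : Tm L → L → Tm L
  | app : Tm L → L → Tm L → Tm L
  | obj : List (L × Option (Tm L)) → Tm L

namespace Tm

variable {L : Type}

/-- Look up a label among the attributes of an object: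
`none` = the label is missing, `some none` = void attribute,
`some (some t)` = attribute attached to `t`. -/
def lookupAttr [DecidableEq L] (a : L) : List (L × Option (Tm L)) → Option (Option (Tm L))
  | [] => none
  | (b, o) :: rest => if a = b then some o else lookupAttr a rest

/-- Attach term `u` to the (first occurrence of) label `a`. -/
def attachAttr [DecidableEq L] (a : L) (u : Tm L) :
    List (L × Option (Tm L)) → List (L × Option (Tm L))
  | [] => []
  | (b, o) :: rest => if a = b then (b, some u) :: rest else (b, o) :: attachAttr a u rest

mutual
/-- Locator increment `↑ₙ t`. -/
def incAt : Nat → Tm L → Tm L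
  | n, loc m => if m < n then loc m else loc (m + 1)
  | n, dot t a => dot (incAt n t) a
  | n, app t a u => app (incAt n t) a (incAt n u)
  | n, obj attrs => obj (incAtList (n + 1) attrs)

def incAtList : Nat → List (L × Option (Tm L)) → List (L × Option (Tm L))
  | _, [] => []
  | n, (a, none) :: rest => (a, none) :: incAtList n rest
  | n, (a, some t) :: rest => (a, some (incAt n t)) :: incAtList n rest
end

mutual
/-- Locator substitution `t[ρ^n ↦ u]`. -/
def subst : Tm L → Nat → Tm L → Tm L
  | loc m, n, u => if m < n then loc m else if m = n then u else loc (m - 1)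
  | dot t a, n, u => dot (subst t n u) a
  | app t a v, n, u => app (subst t n u) a (subst v n u)
  | obj attrs, n, u => obj (substList attrs (n + 1) (incAt 0 u))

def substList : List (L × Option (Tm L)) → Nat → Tm L → List (L × Option (Tm L))
  | [], _, _ => []
  | (a, none) :: rest, n, u => (a, none) :: substList rest n u
  | (a, some t) :: rest, n, u => (a, some (subst t n u)) :: substList rest n u
end

section Reductions

variable [DecidableEq L]

/-- One-step (regular) reduction `⇝`, parametrized by the decorator label `phi`. -/
inductive Step (phi : L) : Tm L → Tm L → Prop where
  | congObj {t t' : Tm L} (pre post : List (L × Option (Tm L))) (b : L) :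
      Step phi t t' →
      Step phi (obj (pre ++ (b, some t) :: post)) (obj (pre ++ (b, some t') :: post))
  | congDot {t t' : Tm L} (a : L) : Step phi t t' → Step phi (dot t a) (dot t' a)
  | congAppL {t t' u : Tm L} (a : L) : Step phi t t' → Step phi (app t a u) (app t' a u)
  | congAppR {t u u' : Tm L} (a : L) : Step phi u u' → Step phi (app t a u) (app t a u')
  | dotStep {attrs : List (L × Option (Tm L))} {c : L} {tc : Tm L} :
      lookupAttr c attrs = some (some tc) →
      Step phi (dot (obj attrs) c) (subst tc 0 (obj attrs))
  | dotPhi {attrs : List (L × Option (Tm L))} {c : L} :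
      lookupAttr c attrs = none → (lookupAttr phi attrs).isSome →
      Step phi (dot (obj attrs) c) (dot (dot (obj attrs) phi) c)
  | appStep {attrs : List (L × Option (Tm L))} {c : L} {u : Tm L} :
      lookupAttr c attrs = some none →
      Step phi (app (obj attrs) c u) (obj (attachAttr c (incAt 0 u) attrs))

mutual
/-- Parallel reduction `⇛`. -/
inductive Par (phi : L) : Tm L → Tm L → Prop where
  | loc (n : Nat) : Par phi (Tm.loc n) (Tm.loc n)
  | obj {attrs attrs' : List (L × Option (Tm L))} :
      ParAttrs phi attrs attrs' → Par phi (Tm.obj attrs) (Tm.obj attrs')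
  | congDot {t t' : Tm L} (a : L) : Par phi t t' → Par phi (Tm.dot t a) (Tm.dot t' a)
  | congApp {t t' u u' : Tm L} (a : L) :
      Par phi t t' → Par phi u u' → Par phi (Tm.app t a u) (Tm.app t' a u')
  | dotPar {t : Tm L} {attrs : List (L × Option (Tm L))} {c : L} {tc : Tm L} :
      Par phi t (Tm.obj attrs) → lookupAttr c attrs = some (some tc) →
      Par phi (Tm.dot t c) (subst tc 0 (Tm.obj attrs))
  | dotPhi {t : Tm L} {attrs : List (L × Option (Tm L))} {c : L} :
      Par phi t (Tm.obj attrs) → lookupAttr c attrs = none →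
      (lookupAttr phi attrs).isSome →
      Par phi (Tm.dot t c) (Tm.dot (Tm.dot (Tm.obj attrs) phi) c)
  | appPar {t : Tm L} {attrs : List (L × Option (Tm L))} {c : L} {u u' : Tm L} :
      Par phi t (Tm.obj attrs) → lookupAttr c attrs = some none → Par phi u u' →
      Par phi (Tm.app t c u) (Tm.obj (attachAttr c (incAt 0 u') attrs))

/-- Pointwise parallel reduction on attribute lists: void attributes are kept,
attached attributes reduce in parallel. -/
inductive ParAttrs (phi : L) :
    List (L × Option (Tm L)) → List (L × Option (Tm L)) → Prop where
  | nil : ParAttrs phi [] []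
  | void {rest rest' : List (L × Option (Tm L))} (a : L) :
      ParAttrs phi rest rest' → ParAttrs phi ((a, none) :: rest) ((a, none) :: rest')
  | attached {t t' : Tm L} {rest rest' : List (L × Option (Tm L))} (a : L) :
      Par phi t t' → ParAttrs phi rest rest' →
      ParAttrs phi ((a, some t) :: rest) ((a, some t') :: rest')
end

/-- Head reduction `→h`. -/
inductive Head (phi : L) : Tm L → Tm L → Prop where
  | dotStep {attrs : List (L × Option (Tm L))} {c : L} {tc : Tm L} :
      lookupAttr c attrs = some (some tc) →
      Head phi (dot (obj attrs) c) (subst tc 0 (obj attrs))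
  | dotPhi {attrs : List (L × Option (Tm L))} {c : L} :
      lookupAttr c attrs = none → (lookupAttr phi attrs).isSome →
      Head phi (dot (obj attrs) c) (dot (dot (obj attrs) phi) c)
  | appStep {attrs : List (L × Option (Tm L))} {c : L} {u : Tm L} :
      lookupAttr c attrs = some none →
      Head phi (app (obj attrs) c u) (obj (attachAttr c (incAt 0 u) attrs))
  | congDot {t t' : Tm L} (a : L) : Head phi t t' → Head phi (dot t a) (dot t' a)
  | congApp {t t' u : Tm L} (a : L) : Head phi t t' → Head phi (app t a u) (app t' a u)

/-- Internal parallel reduction `⇛ᵢ`. -/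
inductive ParI (phi : L) : Tm L → Tm L → Prop where
  | loc (n : Nat) : ParI phi (Tm.loc n) (Tm.loc n)
  | obj {attrs attrs' : List (L × Option (Tm L))} :
      ParAttrs phi attrs attrs' → ParI phi (Tm.obj attrs) (Tm.obj attrs')
  | congDot {t t' : Tm L} (a : L) : ParI phi t t' → ParI phi (Tm.dot t a) (Tm.dot t' a)
  | congApp {t t' u u' : Tm L} (a : L) :
      ParI phi t t' → Par phi u u' → ParI phi (Tm.app t a u) (Tm.app t' a u')

/-- Internal (regular) reduction `→ᵢ`. -/
inductive StepI (phi : L) : Tm L → Tm L → Prop where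
  | congObj {t t' : Tm L} (pre post : List (L × Option (Tm L))) (b : L) :
      Step phi t t' →
      StepI phi (obj (pre ++ (b, some t) :: post)) (obj (pre ++ (b, some t') :: post))
  | congDot {t t' : Tm L} (a : L) : StepI phi t t' → StepI phi (dot t a) (dot t' a)
  | congAppL {t t' u : Tm L} (a : L) : StepI phi t t' → StepI phi (app t a u) (app t' a u)
  | congAppR {t u u' : Tm L} (a : L) : Step phi u u' → StepI phi (app t a u) (app t a u')

end Reductions

end Tm

end PhiCalc
namespace PhiCalc
namespace Tm
section Extra
variable {L : Type} [DecidableEq L]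

mutual
/-- Complete development `t⁺`. -/
def cd (phi : L) : Tm L → Tm L
  | loc n => loc n
  | dot t a =>
    match cd phi t with
    | obj attrs =>
      match lookupAttr a attrs with
      | some (some ta) => subst ta 0 (obj attrs)
      | some none => dot (obj attrs) a
      | none =>
        if (lookupAttr phi attrs).isSome then dot (dot (obj attrs) phi) a
        else dot (obj attrs) a
    | t' => dot t' a
  | app t a u =>
    match cd phi t with
    | obj attrs =>
      match lookupAttr a attrs with
      | some none => obj (attachAttr a (incAt 0 (cd phi u)) attrs)
      | _ => app (obj attrs) a (cd phi u)
    | t' => app t' a (cd phi u)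
  | obj attrs => obj (cdList phi attrs)

def cdList (phi : L) : List (L × Option (Tm L)) → List (L × Option (Tm L))
  | [] => []
  | (a, none) :: rest => (a, none) :: cdList phi rest
  | (a, some t) :: rest => (a, some (cd phi t)) :: cdList phi rest
end

/-- Head reduction as a (deterministic) partial function. -/
def headRed (phi : L) : Tm L → Option (Tm L)
  | loc _ => none
  | obj _ => none
  | dot t a =>
    match t with
    | obj attrs =>
      match lookupAttr a attrs with
      | some (some ta) => some (subst ta 0 (obj attrs))
      | some none => none
      | none =>
        if (lookupAttr phi attrs).isSome then some (dot (dot (obj attrs) phi) a)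
        else none
    | t => (headRed phi t).map (fun t' => dot t' a)
  | app t a u =>
    match t with
    | obj attrs =>
      match lookupAttr a attrs with
      | some none => some (obj (attachAttr a (incAt 0 u) attrs))
      | _ => none
    | t => (headRed phi t).map (fun t' => app t' a u)

mutual
/-- Normal order reduction `⇝ℓ` as a (deterministic) partial function:
head reduction first, otherwise reduce the leftmost subterm that reduces. -/
def nordRed (phi : L) : Tm L → Option (Tm L)
  | loc _ => none
  | dot t a =>
    match headRed phi (dot t a) with
    | some s => some s
    | none => (nordRed phi t).map (fun t' => dot t' a)
  | app t a u =>
    match headRed phi (app t a u) with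
    | some s => some s
    | none =>
      match nordRed phi t with
      | some t' => some (app t' a u)
      | none => (nordRed phi u).map (fun u' => app t a u')
  | obj attrs => (nordList phi attrs).map obj

def nordList (phi : L) : List (L × Option (Tm L)) → Option (List (L × Option (Tm L)))
  | [] => none
  | (a, none) :: rest => (nordList phi rest).map (fun rest' => (a, none) :: rest')
  | (a, some t) :: rest =>
    match nordRed phi t with
    | some t' => some ((a, some t') :: rest)
    | none => (nordList phi rest).map (fun rest' => (a, some t) :: rest')
end

/-- Normal order reduction relation. -/
def NOrd (phi : L) (t t' : Tm L) : Prop := nordRed phi t = some t'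

end Extra
end Tm
end PhiCalc
namespace PhiCalc
namespace Tm

open Relation

section Locators

variable {L : Type}

mutual
theorem incAt_incAt {n k : Nat} (h : n ≤ k) :
    ∀ t : Tm L, incAt (k + 1) (incAt n t) = incAt n (incAt k t)
  | loc m => by grind [incAt]
  | dot t a => by simp only [incAt, incAt_incAt h t]
  | app t a u => by simp only [incAt, incAt_incAt h t, incAt_incAt h u]
  | obj attrs => by simp only [incAt, incAtList_incAtList (Nat.succ_le_succ h) attrs]

theorem incAtList_incAtList {n k : Nat} (h : n ≤ k) :
    ∀ attrs : List (L × Option (Tm L)),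
      incAtList (k + 1) (incAtList n attrs) = incAtList n (incAtList k attrs)
  | [] => by simp only [incAtList]
  | (a, none) :: rest => by simp only [incAtList, incAtList_incAtList h rest]
  | (a, some t) :: rest => by
    simp only [incAtList, incAt_incAt h t, incAtList_incAtList h rest]
end

mutual
theorem subst_incAt_self (n : Nat) (u : Tm L) : ∀ t : Tm L, subst (incAt n t) n u = t
  | loc m => by grind [incAt, subst]
  | dot t a => by simp only [incAt, subst, subst_incAt_self n u t]
  | app t a v => by simp only [incAt, subst, subst_incAt_self n u t, subst_incAt_self n u v]
  | obj attrs => by simp only [incAt, subst, substList_incAtList_self (n + 1) (incAt 0 u) attrs]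

theorem substList_incAtList_self (n : Nat) (u : Tm L) :
    ∀ attrs : List (L × Option (Tm L)), substList (incAtList n attrs) n u = attrs
  | [] => by simp only [incAtList, substList]
  | (a, none) :: rest => by simp only [incAtList, substList, substList_incAtList_self n u rest]
  | (a, some t) :: rest => by
    simp only [incAtList, substList, subst_incAt_self n u t, substList_incAtList_self n u rest]
end

mutual
theorem incAt_subst {n k : Nat} (h : n ≤ k) (u : Tm L) :
    ∀ t : Tm L, incAt k (subst t n u) = subst (incAt (k + 1) t) n (incAt k u)
  | loc m => by grind [incAt, subst]
  | dot t a => by simp only [incAt, subst, incAt_subst h u t]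
  | app t a v => by simp only [incAt, subst, incAt_subst h u t, incAt_subst h u v]
  | obj attrs => by
    simp only [incAt, subst, incAtList_substList (Nat.succ_le_succ h) (incAt 0 u) attrs,
      incAt_incAt (Nat.zero_le k) u]

theorem incAtList_substList {n k : Nat} (h : n ≤ k) (u : Tm L) :
    ∀ attrs : List (L × Option (Tm L)),
      incAtList k (substList attrs n u) = substList (incAtList (k + 1) attrs) n (incAt k u)
  | [] => by simp only [incAtList, substList]
  | (a, none) :: rest => by simp only [incAtList, substList, incAtList_substList h u rest]
  | (a, some t) :: rest => by
    simp only [incAtList, substList, incAt_subst h u t, incAtList_substList h u rest]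
end

mutual
theorem subst_incAt {n k : Nat} (h : n ≤ k) (u : Tm L) :
    ∀ t : Tm L, subst (incAt n t) (k + 1) (incAt n u) = incAt n (subst t k u)
  | loc m => by grind [incAt, subst]
  | dot t a => by simp only [incAt, subst, subst_incAt h u t]
  | app t a v => by simp only [incAt, subst, subst_incAt h u t, subst_incAt h u v]
  | obj attrs => by
    simp only [incAt, subst, ← substList_incAtList (Nat.succ_le_succ h) (incAt 0 u) attrs,
      incAt_incAt (Nat.zero_le n) u]

theorem substList_incAtList {n k : Nat} (h : n ≤ k) (u : Tm L) :
    ∀ attrs : List (L × Option (Tm L)),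
      substList (incAtList n attrs) (k + 1) (incAt n u) = incAtList n (substList attrs k u)
  | [] => by simp only [incAtList, substList]
  | (a, none) :: rest => by simp only [incAtList, substList, substList_incAtList h u rest]
  | (a, some t) :: rest => by
    simp only [incAtList, substList, subst_incAt h u t, substList_incAtList h u rest]
end

mutual
theorem subst_subst {n k : Nat} (h : n ≤ k) (u v : Tm L) :
    ∀ t : Tm L,
      subst (subst t n u) k v = subst (subst t (k + 1) (incAt n v)) n (subst u k v)
  | loc m => by grind [subst, subst_incAt_self]
  | dot t a => by simp only [subst, subst_subst h u v t]
  | app t a w => by simp only [subst, subst_subst h u v t, subst_subst h u v w]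
  | obj attrs => by
    simp only [subst, substList_substList (Nat.succ_le_succ h) (incAt 0 u) (incAt 0 v) attrs,
      incAt_incAt (Nat.zero_le n) v, subst_incAt (Nat.zero_le k) v u]

theorem substList_substList {n k : Nat} (h : n ≤ k) (u v : Tm L) :
    ∀ attrs : List (L × Option (Tm L)),
      substList (substList attrs n u) k v =
        substList (substList attrs (k + 1) (incAt n v)) n (subst u k v)
  | [] => by simp only [substList]
  | (a, none) :: rest => by simp only [substList, substList_substList h u v rest]
  | (a, some t) :: rest => by
    simp only [substList, subst_subst h u v t, substList_substList h u v rest]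
end

end Locators

variable {L : Type} [DecidableEq L]

theorem lookupAttr_incAtList (c : L) (n : Nat) :
    ∀ attrs : List (L × Option (Tm L)),
      lookupAttr c (incAtList n attrs) = (lookupAttr c attrs).map (Option.map (incAt n))
  | [] => rfl
  | (a, none) :: rest => by grind [lookupAttr, incAtList, lookupAttr_incAtList c n rest]
  | (a, some t) :: rest => by grind [lookupAttr, incAtList, lookupAttr_incAtList c n rest]

theorem lookupAttr_substList (c : L) (n : Nat) (u : Tm L) :
    ∀ attrs : List (L × Option (Tm L)),
      lookupAttr c (substList attrs n u) =
        (lookupAttr c attrs).map (Option.map fun t => subst t n u)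
  | [] => rfl
  | (a, none) :: rest => by grind [lookupAttr, substList, lookupAttr_substList c n u rest]
  | (a, some t) :: rest => by grind [lookupAttr, substList, lookupAttr_substList c n u rest]

theorem incAtList_attachAttr (c : L) (n : Nat) (v : Tm L) :
    ∀ attrs : List (L × Option (Tm L)),
      incAtList n (attachAttr c v attrs) = attachAttr c (incAt n v) (incAtList n attrs)
  | [] => rfl
  | (a, none) :: rest => by grind [attachAttr, incAtList, incAtList_attachAttr c n v rest]
  | (a, some t) :: rest => by grind [attachAttr, incAtList, incAtList_attachAttr c n v rest]

theorem substList_attachAttr (c : L) (n : Nat) (u v : Tm L) :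
    ∀ attrs : List (L × Option (Tm L)),
      substList (attachAttr c v attrs) n u = attachAttr c (subst v n u) (substList attrs n u)
  | [] => rfl
  | (a, none) :: rest => by grind [attachAttr, substList, substList_attachAttr c n u v rest]
  | (a, some t) :: rest => by grind [attachAttr, substList, substList_attachAttr c n u v rest]

variable {phi : L}

theorem Head.incAt (n : Nat) {t t' : Tm L} (h : Head phi t t') :
    Head phi (incAt n t) (incAt n t') := by
  induction h with
  | dotStep hc =>
    rw [incAt_subst (Nat.zero_le n)]
    exact .dotStep (by simp [lookupAttr_incAtList, hc])
  | dotPhi hc hphi =>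
    exact .dotPhi (by simp [lookupAttr_incAtList, hc]) (by simpa [lookupAttr_incAtList] using hphi)
  | appStep hc =>
    simp only [Tm.incAt, incAtList_attachAttr, incAt_incAt (Nat.zero_le n)]
    exact .appStep (by simp [lookupAttr_incAtList, hc])
  | congDot a _ ih => exact .congDot a ih
  | congApp a _ ih => exact .congApp a ih

theorem Head.subst (n : Nat) (u : Tm L) {t t' : Tm L} (h : Head phi t t') :
    Head phi (subst t n u) (subst t' n u) := by
  induction h with
  | dotStep hc =>
    rw [subst_subst (Nat.zero_le n)]
    exact .dotStep (by simp [lookupAttr_substList, hc])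
  | dotPhi hc hphi =>
    exact .dotPhi (by simp [lookupAttr_substList, hc]) (by simpa [lookupAttr_substList] using hphi)
  | appStep hc =>
    simp only [Tm.subst, substList_attachAttr, subst_incAt (Nat.zero_le n)]
    exact .appStep (by simp [lookupAttr_substList, hc])
  | congDot a _ ih => exact .congDot a ih
  | congApp a _ ih => exact .congApp a ih

theorem Head.step {t t' : Tm L} (h : Head phi t t') : Step phi t t' := by
  induction h with
  | dotStep hc => exact .dotStep hc
  | dotPhi hc hphi => exact .dotPhi hc hphi
  | appStep hc => exact .appStep hc
  | congDot a _ ih => exact .congDot a ih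
  | congApp a _ ih => exact .congAppL a ih

theorem StepI.step {t t' : Tm L} (h : StepI phi t t') : Step phi t t' := by
  induction h with
  | congObj pre post b h => exact .congObj pre post b h
  | congDot a _ ih => exact .congDot a ih
  | congAppL a _ ih => exact .congAppL a ih
  | congAppR a h => exact .congAppR a h

mutual
/-- `Standard phi t s`: head reduction takes `t` to a term with the same outermost constructor
as `s`, whose immediate subterms are in turn related to those of `s`. -/
inductive Standard (phi : L) : Tm L → Tm L → Prop where
  | loc {t : Tm L} {n : Nat} : ReflTransGen (Head phi) t (loc n) → Standard phi t (loc n)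
  | dot {t u u' : Tm L} {a : L} :
      ReflTransGen (Head phi) t (dot u a) → Standard phi u u' → Standard phi t (dot u' a)
  | app {t u u' v v' : Tm L} {a : L} :
      ReflTransGen (Head phi) t (app u a v) → Standard phi u u' → Standard phi v v' →
      Standard phi t (app u' a v')
  | obj {t : Tm L} {attrs attrs' : List (L × Option (Tm L))} :
      ReflTransGen (Head phi) t (obj attrs) → StandardAttrs phi attrs attrs' →
      Standard phi t (obj attrs')

/-- Pointwise extension of `Standard` to attribute lists. -/
inductive StandardAttrs (phi : L) :
    List (L × Option (Tm L)) → List (L × Option (Tm L)) → Prop where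
  | nil : StandardAttrs phi [] []
  | void {rest rest' : List (L × Option (Tm L))} (a : L) :
      StandardAttrs phi rest rest' → StandardAttrs phi ((a, none) :: rest) ((a, none) :: rest')
  | attached {t t' : Tm L} {rest rest' : List (L × Option (Tm L))} (a : L) :
      Standard phi t t' → StandardAttrs phi rest rest' →
      StandardAttrs phi ((a, some t) :: rest) ((a, some t') :: rest')
end

mutual
theorem Standard.refl : ∀ t : Tm L, Standard phi t t
  | Tm.loc _ => .loc .refl
  | Tm.dot t _ => .dot .refl (Standard.refl t)
  | Tm.app t _ u => .app .refl (Standard.refl t) (Standard.refl u)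
  | Tm.obj attrs => .obj .refl (StandardAttrs.refl attrs)

theorem StandardAttrs.refl : ∀ attrs : List (L × Option (Tm L)), StandardAttrs phi attrs attrs
  | [] => .nil
  | (a, none) :: rest => .void a (StandardAttrs.refl rest)
  | (a, some t) :: rest => .attached a (Standard.refl t) (StandardAttrs.refl rest)
end

theorem Standard.head_trans {t t' s : Tm L} (h : ReflTransGen (Head phi) t t')
    (hs : Standard phi t' s) : Standard phi t s := by
  cases hs with
  | loc h' => exact .loc (h.trans h')
  | dot h' hu => exact .dot (h.trans h') hu
  | app h' hu hv => exact .app (h.trans h') hu hv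
  | obj h' ha => exact .obj (h.trans h') ha

mutual
theorem Standard.incAt (n : Nat) {t t' : Tm L} :
    Standard phi t t' → Standard phi (Tm.incAt n t) (Tm.incAt n t')
  | .loc h => .head_trans (h.lift _ fun _ _ => Head.incAt n) (.refl _)
  | .dot h hu => .dot (h.lift _ fun _ _ => Head.incAt n) (hu.incAt n)
  | .app h hu hv => .app (h.lift _ fun _ _ => Head.incAt n) (hu.incAt n) (hv.incAt n)
  | .obj h ha => .obj (h.lift _ fun _ _ => Head.incAt n) (ha.incAtList (n + 1))

theorem StandardAttrs.incAtList (n : Nat) {attrs attrs' : List (L × Option (Tm L))} :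
    StandardAttrs phi attrs attrs' →
      StandardAttrs phi (Tm.incAtList n attrs) (Tm.incAtList n attrs')
  | .nil => .nil
  | .void a h => .void a (h.incAtList n)
  | .attached a ht h => .attached a (ht.incAt n) (h.incAtList n)
end

mutual
theorem Standard.subst (n : Nat) {u u' : Tm L} (hs : Standard phi u u') {t t' : Tm L} :
    Standard phi t t' → Standard phi (Tm.subst t n u) (Tm.subst t' n u')
  | .loc h => by
    refine .head_trans (h.lift (fun t => Tm.subst t n u) fun _ _ => Head.subst n u) ?_
    simp only [Tm.subst]
    split_ifs
    · exact .refl _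
    · exact hs
    · exact .refl _
  | .dot h hu =>
    .dot (h.lift (fun t => Tm.subst t n u) fun _ _ => Head.subst n u) (hs.subst n hu)
  | .app h hu hv =>
    .app (h.lift (fun t => Tm.subst t n u) fun _ _ => Head.subst n u) (hs.subst n hu)
      (hs.subst n hv)
  | .obj h ha =>
    .obj (h.lift (fun t => Tm.subst t n u) fun _ _ => Head.subst n u)
      (ha.substList (n + 1) (hs.incAt 0))

theorem StandardAttrs.substList (n : Nat) {u u' : Tm L} (hs : Standard phi u u')
    {attrs attrs' : List (L × Option (Tm L))} :
    StandardAttrs phi attrs attrs' →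
      StandardAttrs phi (Tm.substList attrs n u) (Tm.substList attrs' n u')
  | .nil => .nil
  | .void a h => .void a (h.substList n hs)
  | .attached a ht h => .attached a (hs.subst n ht) (h.substList n hs)
end

theorem StandardAttrs.lookupAttr_eq_none_iff (c : L) :
    ∀ {attrs attrs' : List (L × Option (Tm L))}, StandardAttrs phi attrs attrs' →
      (lookupAttr c attrs = none ↔ lookupAttr c attrs' = none)
  | _, _, .nil => Iff.rfl
  | _, _, .void a h => by grind [lookupAttr, h.lookupAttr_eq_none_iff c]
  | _, _, .attached a _ h => by grind [lookupAttr, h.lookupAttr_eq_none_iff c]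

theorem StandardAttrs.lookupAttr_void {c : L} :
    ∀ {attrs attrs' : List (L × Option (Tm L))}, StandardAttrs phi attrs attrs' →
      lookupAttr c attrs' = some none → lookupAttr c attrs = some none
  | _, _, .nil, hc => hc
  | _, _, .void a h, hc => by grind [lookupAttr, h.lookupAttr_void (c := c)]
  | _, _, .attached a _ h, hc => by grind [lookupAttr, h.lookupAttr_void (c := c)]

theorem StandardAttrs.lookupAttr_attached {c : L} {t' : Tm L} :
    ∀ {attrs attrs' : List (L × Option (Tm L))}, StandardAttrs phi attrs attrs' →
      lookupAttr c attrs' = some (some t') →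
      ∃ t, lookupAttr c attrs = some (some t) ∧ Standard phi t t'
  | _, _, .void a h, hc => by
    have ih := h.lookupAttr_attached (c := c) (t' := t')
    grind [lookupAttr]
  | _, _, .attached a ht h, hc => by
    have ih := h.lookupAttr_attached (c := c) (t' := t')
    grind [lookupAttr]

theorem StandardAttrs.attachAttr (c : L) {u u' : Tm L} (hu : Standard phi u u') :
    ∀ {attrs attrs' : List (L × Option (Tm L))}, StandardAttrs phi attrs attrs' →
      StandardAttrs phi (Tm.attachAttr c u attrs) (Tm.attachAttr c u' attrs')
  | _, _, .nil => .nil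
  | _, _, .void a h => by
    simp only [Tm.attachAttr]
    split_ifs
    · exact .attached a hu h
    · exact .void a (h.attachAttr c hu)
  | _, _, .attached a ht h => by
    simp only [Tm.attachAttr]
    split_ifs
    · exact .attached a hu h
    · exact .attached a ht (h.attachAttr c hu)

theorem StandardAttrs.replace {s s' : Tm L} (b : L)
    (hs : ∀ t : Tm L, Standard phi t s → Standard phi t s')
    {post : List (L × Option (Tm L))} :
    ∀ (pre : List (L × Option (Tm L))) {attrs : List (L × Option (Tm L))},
      StandardAttrs phi attrs (pre ++ (b, some s) :: post) →
      StandardAttrs phi attrs (pre ++ (b, some s') :: post)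
  | [], _, .attached _ ht h => .attached b (hs _ ht) h
  | _ :: pre, _, .void a h => .void a (h.replace b hs pre)
  | _ :: pre, _, .attached a ht h => .attached a ht (h.replace b hs pre)

theorem Standard.step_trans {t s s' : Tm L} (h : Standard phi t s) (hs : Step phi s s') :
    Standard phi t s' := by
  induction hs generalizing t with
  | congObj pre post b _ ih =>
    cases h with
    | obj h ha => exact .obj h (ha.replace b (fun _ => ih) pre)
  | congDot a _ ih =>
    cases h with
    | dot h hu => exact .dot h (ih hu)
  | congAppL a _ ih =>
    cases h with
    | app h hu hv => exact .app h (ih hu) hv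
  | congAppR a _ ih =>
    cases h with
    | app h hu hv => exact .app h hu (ih hv)
  | dotStep hc =>
    cases h with
    | dot h hu =>
    cases hu with
    | obj hu ha =>
    obtain ⟨tc, htc, hst⟩ := ha.lookupAttr_attached hc
    exact .head_trans ((h.trans (hu.lift (fun t => Tm.dot t _) fun _ _ => .congDot _)).tail
      (.dotStep htc)) (.subst 0 (.obj .refl ha) hst)
  | dotPhi hc hphi =>
    cases h with
    | dot h hu =>
    cases hu with
    | obj hu ha =>
    refine .dot ((h.trans (hu.lift (fun t => Tm.dot t _) fun _ _ => .congDot _)).tail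
      (.dotPhi ((ha.lookupAttr_eq_none_iff _).2 hc) ?_)) (.dot .refl (.obj .refl ha))
    rw [Option.isSome_iff_ne_none] at hphi ⊢
    exact mt (ha.lookupAttr_eq_none_iff _).1 hphi
  | appStep hc =>
    cases h with
    | app h hu hv =>
    cases hu with
    | obj hu ha =>
    exact .obj ((h.trans (hu.lift (fun t => Tm.app t _ _) fun _ _ => .congApp _)).tail
      (.appStep (ha.lookupAttr_void hc))) (ha.attachAttr _ (hv.incAt 0))

theorem reflTransGen_step_of_head_stepI {t r s : Tm L} (hr : ReflTransGen (Head phi) t r)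
    (hs : ReflTransGen (StepI phi) r s) : ReflTransGen (Step phi) t s :=
  (hr.lift id fun _ _ => Head.step).trans (hs.lift id fun _ _ => StepI.step)

mutual
theorem Standard.exists_head_stepI {t s : Tm L} :
    Standard phi t s →
      ∃ r, ReflTransGen (Head phi) t r ∧ ReflTransGen (StepI phi) r s
  | .loc h => ⟨_, h, .refl⟩
  | .dot h hu =>
    let ⟨r, hr, hs⟩ := hu.exists_head_stepI
    ⟨Tm.dot r _, h.trans (hr.lift (fun t => Tm.dot t _) fun _ _ => .congDot _),
      hs.lift (fun t => Tm.dot t _) fun _ _ => .congDot _⟩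
  | .app (v := v) (u' := u') h hu hv =>
    let ⟨r, hr, hs⟩ := hu.exists_head_stepI
    let ⟨_, hr', hs'⟩ := hv.exists_head_stepI
    ⟨Tm.app r _ v, h.trans (hr.lift (fun t => Tm.app t _ v) fun _ _ => .congApp _),
      (hs.lift (fun t => Tm.app t _ v) fun _ _ => .congAppL _).trans
        ((reflTransGen_step_of_head_stepI hr' hs').lift (Tm.app u' _) fun _ _ => .congAppR _)⟩
  | .obj h ha => ⟨_, h, ha.stepI []⟩

theorem StandardAttrs.stepI {attrs attrs' : List (L × Option (Tm L))} :
    StandardAttrs phi attrs attrs' → ∀ pre : List (L × Option (Tm L)),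
      ReflTransGen (StepI phi) (Tm.obj (pre ++ attrs)) (Tm.obj (pre ++ attrs'))
  | .nil, _ => .refl
  | .void a h, pre => by
    have := h.stepI (pre ++ [(a, none)])
    simpa only [List.append_assoc, List.cons_append, List.nil_append] using this
  | .attached (t' := t') (rest := rest) a ht h, pre => by
    obtain ⟨_, hr, hs⟩ := ht.exists_head_stepI
    refine ((reflTransGen_step_of_head_stepI hr hs).lift
      (fun t => Tm.obj (pre ++ (a, some t) :: rest)) fun _ _ => .congObj pre rest a).trans ?_
    have := h.stepI (pre ++ [(a, some t')])
    simpa only [List.append_assoc, List.cons_append, List.nil_append] using this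
end

end Tm
end PhiCalc

open PhiCalc Tm in
/-- Standardization theorem: if `t ⇝* s` then there is `r` with
`t →h* r →ᵢ* s`. -/
theorem standardization {L : Type} [DecidableEq L] (phi : L) {t s : Tm L}
    (h : Relation.ReflTransGen (Step phi) t s) :
    ∃ r : Tm L, Relation.ReflTransGen (Head phi) t r ∧
      Relation.ReflTransGen (StepI phi) r s := by
  have hs : Standard phi t s := by
    induction h with
    | refl => exact .refl t
    | tail _ h ih => exact ih.step_trans h
  exact hs.exists_head_stepI
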